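/- arXiv:2206.09192 — 6 statements merged into one kernel-verified Lean document; each statement's English description precedes it below -/
import Mathlib

section
/- Let a ∈ ℝ and define Φ : 𝔻 → ℂ by Φ(z) = (i(1−z)/(1+z))^{2(1+ia)/(1+a²)} (principal complex power). Then Φ is holomorphic and injective on 𝔻, and its image is Φ(𝔻) = ℂ ∖ ({0} ∪ {e^{(1+ia)t} : t ∈ ℝ}), i.e. Φ maps the unit disk conformally onto the complement of the closed complete logarithmic spiral. -/
open Complex Filter Topology Set

/-- The conformal map from the unit disk onto the complement of the complete
logarithmic spiral with parameter `a`: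
`Φ(z) = (i(1−z)/(1+z))^{2(1+ia)/(1+a²)}` (principal complex power). -/
noncomputable def spiralMap (a : ℝ) : ℂ → ℂ :=
  fun z => (Complex.I * (1 - z) / (1 + z)) ^
    ((2 * (1 + (a : ℂ) * Complex.I)) / (1 + (a : ℂ) ^ 2))

theorem im_I_mul_one_sub_div_one_add_pos {z : ℂ} (hz : z ∈ Metric.ball (0 : ℂ) 1) :
    0 < (Complex.I * (1 - z) / (1 + z)).im := by
  rw [mem_ball_zero_iff] at hz
  have h1 : (1 + z) ≠ 0 := by
    intro h
    rw [eq_neg_of_add_eq_zero_right h] at hz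
    simp at hz
  have hpos : 0 < Complex.normSq (1 + z) := Complex.normSq_pos.mpr h1
  have hz2 : Complex.normSq z < 1 := by
    rw [Complex.normSq_eq_norm_sq]
    nlinarith [norm_nonneg z]
  have key : (Complex.I * (1 - z) / (1 + z)).im
      = (1 - Complex.normSq z) / Complex.normSq (1 + z) := by
    rw [Complex.div_im]
    field_simp
    simp [Complex.normSq_apply]
    ring
  rw [key]
  exact div_pos (by linarith) hpos

theorem exists_ball_I_mul_one_sub_div_one_add_eq {ζ : ℂ} (hζ : 0 < ζ.im) :
    ∃ z ∈ Metric.ball (0 : ℂ) 1, Complex.I * (1 - z) / (1 + z) = ζ := by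
  have h1 : Complex.I + ζ ≠ 0 := by
    intro h
    have := congrArg Complex.im h
    simp at this
    linarith
  refine ⟨(Complex.I - ζ) / (Complex.I + ζ), ?_, ?_⟩
  · rw [mem_ball_zero_iff, norm_div, div_lt_one (norm_pos_iff.mpr h1),
      ← sq_lt_sq₀ (norm_nonneg _) (norm_nonneg _), ← Complex.normSq_eq_norm_sq,
      ← Complex.normSq_eq_norm_sq, Complex.normSq_apply, Complex.normSq_apply]
    simp
    nlinarith
  · have h2 : 1 + (Complex.I - ζ) / (Complex.I + ζ) = 2 * Complex.I / (Complex.I + ζ) := by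
      field_simp
      ring
    have h3 : 1 - (Complex.I - ζ) / (Complex.I + ζ) = 2 * ζ / (Complex.I + ζ) := by
      field_simp
      ring
    rw [h2, h3]
    field_simp

theorem injOn_I_mul_one_sub_div_one_add :
    Set.InjOn (fun z : ℂ => Complex.I * (1 - z) / (1 + z)) (Metric.ball (0 : ℂ) 1) := by
  have hne : ∀ z ∈ Metric.ball (0 : ℂ) 1, 1 + z ≠ 0 := by
    intro z hz h
    have := im_I_mul_one_sub_div_one_add_pos hz
    simp [h] at this
  intro z hz w hw h
  have h1 := hne z hz
  have h2 := hne w hw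
  simp only at h
  rw [div_eq_div_iff h1 h2] at h
  have h3 : Complex.I * (2 * (w - z)) = 0 := by linear_combination h
  have h4 : w - z = 0 := by simpa using h3
  exact (sub_eq_zero.mp h4).symm

theorem one_add_ofReal_sq_ne_zero (a : ℝ) : (1 + (a : ℂ) ^ 2) ≠ 0 := by
  exact_mod_cast (by positivity : (1 + a ^ 2 : ℝ) ≠ 0)

theorem exp_spiral_exponent_mul_eq_iff (a : ℝ) (L M : ℂ) :
    Complex.exp ((2 * (1 + (a : ℂ) * Complex.I)) / (1 + (a : ℂ) ^ 2) * L) =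
      Complex.exp ((2 * (1 + (a : ℂ) * Complex.I)) / (1 + (a : ℂ) ^ 2) * M) ↔
    ∃ n : ℤ, L = M + n * (Real.pi * (a + Complex.I)) := by
  have h := one_add_ofReal_sq_ne_zero a
  have hI := Complex.I_sq
  set s := (2 * (1 + (a : ℂ) * Complex.I)) / (1 + (a : ℂ) ^ 2) with hs
  have hs1 : s * (1 - a * Complex.I) = 2 := by
    rw [hs]
    field_simp
    linear_combination (-(a : ℂ) ^ 2) * hI
  rw [Complex.exp_eq_exp_iff_exists_int]
  refine exists_congr fun n => ⟨fun e => ?_, fun e => ?_⟩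
  · linear_combination (1 - a * Complex.I) / 2 * e - (L - M) / 2 * hs1
      - n * Real.pi * a * hI
  · rw [e]
    linear_combination n * Real.pi * Complex.I * hs1 + s * n * Real.pi * a * hI

theorem spiralMap_eq_exp (a : ℝ) {z : ℂ} (hz : z ∈ Metric.ball (0 : ℂ) 1) :
    spiralMap a z = Complex.exp ((2 * (1 + (a : ℂ) * Complex.I)) / (1 + (a : ℂ) ^ 2) *
      Complex.log (Complex.I * (1 - z) / (1 + z))) := by
  have h := im_I_mul_one_sub_div_one_add_pos hz
  rw [spiralMap, Complex.cpow_def_of_ne_zero, mul_comm]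
  intro h0
  simp [h0] at h

theorem log_im_mem_Ioo {ζ : ℂ} (h : 0 < ζ.im) : (Complex.log ζ).im ∈ Set.Ioo 0 Real.pi := by
  rw [Complex.log_im]
  refine ⟨lt_of_le_of_ne (Complex.arg_nonneg_iff.mpr h.le) fun h0 => ?_,
    lt_of_le_of_ne (Complex.arg_le_pi _) fun h0 => ?_⟩
  · exact h.ne' (Complex.arg_eq_zero_iff.mp h0.symm).2
  · exact h.ne' (Complex.arg_eq_pi_iff.mp h0).2

theorem int_eq_zero_of_mul_pi_mem_Ioo {n : ℤ} (h1 : -Real.pi < n * Real.pi)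
    (h2 : n * Real.pi < Real.pi) : n = 0 := by
  have h3 : (-1 : ℝ) < n := by nlinarith [Real.pi_pos]
  have h4 : (n : ℝ) < 1 := by nlinarith [Real.pi_pos]
  have h5 : -1 < n := by exact_mod_cast h3
  have h6 : n < 1 := by exact_mod_cast h4
  omega

theorem exp_spiral_eq (a t : ℝ) :
    Complex.exp ((1 + (a : ℂ) * Complex.I) * (t : ℂ)) =
      Complex.exp ((2 * (1 + (a : ℂ) * Complex.I)) / (1 + (a : ℂ) ^ 2) *
        (((1 + a ^ 2) / 2 * t : ℝ) : ℂ)) := by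
  have h := one_add_ofReal_sq_ne_zero a
  congr 1
  push_cast
  field_simp

theorem differentiableOn_spiralMap (a : ℝ) :
    DifferentiableOn ℂ (spiralMap a) (Metric.ball (0 : ℂ) 1) := by
  intro z hz
  have h := im_I_mul_one_sub_div_one_add_pos hz
  have h1 : 1 + z ≠ 0 := by
    intro h0
    simp [h0] at h
  have hd : DifferentiableAt ℂ (fun z : ℂ => Complex.I * (1 - z) / (1 + z)) z :=
    DifferentiableAt.div (by fun_prop) (by fun_prop) h1
  exact (hd.cpow_const (Or.inr h.ne')).differentiableWithinAt

theorem injOn_spiralMap (a : ℝ) : Set.InjOn (spiralMap a) (Metric.ball (0 : ℂ) 1) := by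
  intro z hz w hw e
  rw [spiralMap_eq_exp a hz, spiralMap_eq_exp a hw, exp_spiral_exponent_mul_eq_iff] at e
  obtain ⟨n, hn⟩ := e
  have hz' := im_I_mul_one_sub_div_one_add_pos hz
  have hw' := im_I_mul_one_sub_div_one_add_pos hw
  apply injOn_I_mul_one_sub_div_one_add hz hw
  simp only
  generalize Complex.I * (1 - z) / (1 + z) = ζ at *
  generalize Complex.I * (1 - w) / (1 + w) = ω at *
  obtain ⟨h1, h2⟩ := log_im_mem_Ioo hz'
  obtain ⟨h3, h4⟩ := log_im_mem_Ioo hw'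
  have him : (Complex.log ζ).im = (Complex.log ω).im + n * Real.pi := by
    rw [hn]
    simp
  obtain rfl := int_eq_zero_of_mul_pi_mem_Ioo (n := n) (by linarith) (by linarith)
  have hζ : ζ ≠ 0 := by
    rintro rfl
    simp at hz'
  have hω : ω ≠ 0 := by
    rintro rfl
    simp at hw'
  rw [← Complex.exp_log hζ, ← Complex.exp_log hω, hn]
  simp

theorem image_spiralMap (a : ℝ) :
    spiralMap a '' (Metric.ball (0 : ℂ) 1) =
      ({0} ∪ {w : ℂ | ∃ t : ℝ, w = Complex.exp ((1 + (a : ℂ) * Complex.I) * (t : ℂ))})ᶜ := by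
  ext w
  simp only [Set.mem_image, Set.mem_compl_iff, Set.mem_union, Set.mem_singleton_iff,
    Set.mem_ofPred_eq, not_or]
  constructor
  · rintro ⟨z, hz, rfl⟩
    rw [spiralMap_eq_exp a hz]
    refine ⟨Complex.exp_ne_zero _, ?_⟩
    rintro ⟨t, ht⟩
    rw [exp_spiral_eq, exp_spiral_exponent_mul_eq_iff] at ht
    obtain ⟨n, hn⟩ := ht
    obtain ⟨h1, h2⟩ := log_im_mem_Ioo (im_I_mul_one_sub_div_one_add_pos hz)
    have him : (Complex.log (Complex.I * (1 - z) / (1 + z))).im = n * Real.pi := by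
      rw [hn, Complex.add_im, Complex.ofReal_im]
      simp
    obtain rfl := int_eq_zero_of_mul_pi_mem_Ioo (n := n) (by linarith) (by linarith)
    simp [him] at h1
  · rintro ⟨hw, hspiral⟩
    have h := one_add_ofReal_sq_ne_zero a
    set M : ℂ := (1 - a * Complex.I) / 2 * Complex.log w with hM
    have hwM : w = Complex.exp ((2 * (1 + (a : ℂ) * Complex.I)) / (1 + (a : ℂ) ^ 2) * M) := by
      conv_lhs => rw [← Complex.exp_log hw]
      congr 1
      rw [hM]
      field_simp
      linear_combination (Complex.log w * (a : ℂ) ^ 2) * Complex.I_sq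
    set n : ℤ := ⌊M.im / Real.pi⌋ with hn
    set L : ℂ := M + (-n : ℤ) * (Real.pi * (a + Complex.I)) with hL
    have hwL : w = Complex.exp ((2 * (1 + (a : ℂ) * Complex.I)) / (1 + (a : ℂ) ^ 2) * L) :=
      hwM.trans ((exp_spiral_exponent_mul_eq_iff a L M).mpr ⟨-n, hL⟩).symm
    have hLim : L.im = M.im - n * Real.pi := by
      rw [hL]
      simp
      ring
    have hn1 : n * Real.pi ≤ M.im := (le_div_iff₀ Real.pi_pos).mp (Int.floor_le _)
    have hn2 : M.im < (n + 1) * Real.pi :=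
      (div_lt_iff₀ Real.pi_pos).mp (Int.lt_floor_add_one _)
    have hL0 : L.im ≠ 0 := by
      intro h0
      refine hspiral ⟨2 * L.re / (1 + a ^ 2), ?_⟩
      rw [exp_spiral_eq, hwL]
      have hr : (1 + a ^ 2) / 2 * (2 * L.re / (1 + a ^ 2)) = L.re := by
        have : (1 + a ^ 2) ≠ 0 := by positivity
        field_simp
      rw [hr, Complex.ext (z := (L.re : ℂ)) (w := L) (by simp) (by simp [h0])]
    have hLpos : 0 < L.im := lt_of_le_of_ne (by linarith) hL0.symm
    have hLlt : L.im < Real.pi := by linarith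
    have him : 0 < (Complex.exp L).im := by
      rw [Complex.exp_im]
      exact mul_pos (Real.exp_pos _) (Real.sin_pos_of_pos_of_lt_pi hLpos hLlt)
    obtain ⟨z, hz, hzL⟩ := exists_ball_I_mul_one_sub_div_one_add_eq him
    refine ⟨z, hz, ?_⟩
    rw [spiralMap_eq_exp a hz, hzL, Complex.log_exp (by linarith [Real.pi_pos]) hLlt.le, ← hwL]

/-- `Φ` maps the unit disk conformally (holomorphically and injectively) onto the
complement of the closed complete logarithmic spiral
`{0} ∪ {e^{(1+ia)t} : t ∈ ℝ}`. -/
theorem spiralMap_conformal_onto_spiral_complement (a : ℝ) :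
    DifferentiableOn ℂ (spiralMap a) (Metric.ball (0 : ℂ) 1) ∧
    Set.InjOn (spiralMap a) (Metric.ball (0 : ℂ) 1) ∧
    spiralMap a '' (Metric.ball (0 : ℂ) 1) =
      ({0} ∪ {w : ℂ | ∃ t : ℝ, w = Complex.exp ((1 + (a : ℂ) * Complex.I) * (t : ℂ))})ᶜ := by
  exact ⟨differentiableOn_spiralMap a, injOn_spiralMap a, image_spiralMap a⟩
end

section
/- Let κ > 0, a ∈ ℝ and α ∈ ℂ, and set p := −(κ/2)α² + (2 + κ/2)α, q := −κα² + (κ/2 + 3 + ia)α (the complex 'red parabola'). Define G : 𝔻 × 𝔻 → ℂ by G(z, w) := (1−z)^α · (1−w)^{conj(α)} · (1−zw)^{−(κ/2)|α|²} (principal powers). Then G satisfies the partial differential equation 𝒫(D)G = 0 on 𝔻 × 𝔻, where 𝒫(D)G(z,w) := −(κ/2)(z∂_z − w∂_w)²G + z((z+1)/(z−1) + ia)∂_z G + w((w+1)/(w−1) − ia)∂_w G + (p − q + conj(p) − conj(q))·G − (p/(1−z)²)G + (q/(1−z))G − (conj(p)/(1−w)²)G + (conj(q)/(1−w))G. -/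
open Complex

lemma one_sub_mem_slitPlane {x : ℂ} (hx : x ∈ Metric.ball (0 : ℂ) 1) : 1 - x ∈ slitPlane := by
  have h : ‖x‖ < 1 := by simpa using hx
  refine Or.inl ?_
  have := re_le_norm x
  simp only [sub_re, one_re]
  linarith

lemma mul_mem_unit_ball {x y : ℂ} (hx : x ∈ Metric.ball (0 : ℂ) 1)
    (hy : y ∈ Metric.ball (0 : ℂ) 1) : x * y ∈ Metric.ball (0 : ℂ) 1 := by
  simp only [mem_ball_zero_iff, norm_mul] at *
  exact mul_lt_one_of_nonneg_of_lt_one_left (norm_nonneg x) hx hy.le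

/-- The product `(1 - z)^α (1 - w)^β (1 - zw)^γ` of principal powers. -/
noncomputable def powerProduct (α β γ z w : ℂ) : ℂ :=
  (1 - z) ^ α * (1 - w) ^ β * (1 - z * w) ^ γ

lemma powerProduct_swap (α β γ z w : ℂ) :
    powerProduct α β γ z w = powerProduct β α γ w z := by
  simp only [powerProduct, mul_comm z w]
  ring

/-- The logarithmic Euler derivative of `powerProduct` in its first variable. -/
noncomputable def eulerFactor (α γ z w : ℂ) : ℂ :=
  -α * (z / (1 - z)) - γ * (z * w / (1 - z * w))

lemma hasDerivAt_one_sub_cpow {x : ℂ} (hx : 1 - x ∈ slitPlane) (c : ℂ) :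
    HasDerivAt (fun u : ℂ => (1 - u) ^ c) ((1 - x) ^ c * (-c / (1 - x))) x := by
  have h : HasDerivAt (fun u : ℂ => (1 - u) ^ c) (c * (1 - x) ^ (c - 1) * -1) x :=
    ((hasDerivAt_id x).const_sub 1).cpow_const (c := c) hx
  refine h.congr_deriv ?_
  rw [cpow_sub _ _ (slitPlane_ne_zero hx), cpow_one]
  ring

lemma hasDerivAt_powerProduct_left {z w : ℂ} (hz : z ∈ Metric.ball (0 : ℂ) 1)
    (hw : w ∈ Metric.ball (0 : ℂ) 1) (α β γ : ℂ) :
    HasDerivAt (fun u => powerProduct α β γ u w)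
      (powerProduct α β γ z w * (-α / (1 - z) - γ * w / (1 - z * w))) z := by
  have h1 := hasDerivAt_one_sub_cpow (one_sub_mem_slitPlane hz) α
  have h2 : HasDerivAt (fun u : ℂ => (1 - u * w) ^ γ)
      ((1 - z * w) ^ γ * (-γ / (1 - z * w)) * (1 * w)) z :=
    (hasDerivAt_one_sub_cpow (one_sub_mem_slitPlane (mul_mem_unit_ball hz hw)) γ).comp
      (h := fun u : ℂ => u * w) z ((hasDerivAt_id z).mul_const w)
  have h := (h1.mul_const ((1 - w) ^ β)).mul h2
  refine h.congr_deriv ?_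
  simp only [powerProduct]
  ring

lemma euler_powerProduct_left {z w : ℂ} (hz : z ∈ Metric.ball (0 : ℂ) 1)
    (hw : w ∈ Metric.ball (0 : ℂ) 1) (α β γ : ℂ) :
    z * deriv (fun u => powerProduct α β γ u w) z =
      powerProduct α β γ z w * eulerFactor α γ z w := by
  rw [(hasDerivAt_powerProduct_left hz hw α β γ).deriv, eulerFactor]
  ring

lemma euler_powerProduct_right {z w : ℂ} (hz : z ∈ Metric.ball (0 : ℂ) 1)
    (hw : w ∈ Metric.ball (0 : ℂ) 1) (α β γ : ℂ) :
    w * deriv (fun v => powerProduct α β γ z v) w =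
      powerProduct α β γ z w * eulerFactor β γ w z := by
  simp only [powerProduct_swap α β γ z]
  exact euler_powerProduct_left hw hz β α γ

lemma euler_powerProduct_mul_left {z w : ℂ} (hz : z ∈ Metric.ball (0 : ℂ) 1)
    (hw : w ∈ Metric.ball (0 : ℂ) 1) (α β γ : ℂ) {f : ℂ → ℂ} {f' : ℂ} (hf : HasDerivAt f f' z)
    {F : ℂ → ℂ} (hF : ∀ u ∈ Metric.ball (0 : ℂ) 1, F u = powerProduct α β γ u w * f u) :
    z * deriv F z =
      powerProduct α β γ z w * (eulerFactor α γ z w * f z + z * f') := by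
  have he : F =ᶠ[nhds z] fun u => powerProduct α β γ u w * f u :=
    Filter.eventuallyEq_of_mem (Metric.isOpen_ball.mem_nhds hz) hF
  rw [(((hasDerivAt_powerProduct_left hz hw α β γ).mul hf).congr_of_eventuallyEq he).deriv,
    eulerFactor]
  ring

lemma euler_powerProduct_mul_right {z w : ℂ} (hz : z ∈ Metric.ball (0 : ℂ) 1)
    (hw : w ∈ Metric.ball (0 : ℂ) 1) (α β γ : ℂ) {f : ℂ → ℂ} {f' : ℂ} (hf : HasDerivAt f f' w)
    {F : ℂ → ℂ} (hF : ∀ v ∈ Metric.ball (0 : ℂ) 1, F v = powerProduct α β γ z v * f v) :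
    w * deriv F w =
      powerProduct α β γ z w * (eulerFactor β γ w z * f w + w * f') := by
  simp only [powerProduct_swap α β γ z] at hF ⊢
  exact euler_powerProduct_mul_left hw hz β α γ hf hF

lemma hasDerivAt_eulerFactor_left {z w : ℂ} (hz : z ∈ Metric.ball (0 : ℂ) 1)
    (hw : w ∈ Metric.ball (0 : ℂ) 1) (α γ : ℂ) :
    HasDerivAt (fun u => eulerFactor α γ u w)
      (-α / (1 - z) ^ 2 - γ * w / (1 - z * w) ^ 2) z := by
  have n1 := slitPlane_ne_zero (one_sub_mem_slitPlane hz)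
  have n2 := slitPlane_ne_zero (one_sub_mem_slitPlane (mul_mem_unit_ball hz hw))
  have h1 := (hasDerivAt_id z).div ((hasDerivAt_id z).const_sub 1) n1
  have hm := (hasDerivAt_id z).mul_const w
  have h2 := hm.div (hm.const_sub 1) n2
  refine ((h1.const_mul (-α)).sub (h2.const_mul γ)).congr_deriv ?_
  simp only [id]
  ring

lemma hasDerivAt_eulerFactor_right {z w : ℂ} (hz : z ∈ Metric.ball (0 : ℂ) 1)
    (hw : w ∈ Metric.ball (0 : ℂ) 1) (α γ : ℂ) :
    HasDerivAt (fun v => eulerFactor α γ z v) (-(γ * z) / (1 - z * w) ^ 2) w := by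
  have n2 := slitPlane_ne_zero (one_sub_mem_slitPlane (mul_mem_unit_ball hz hw))
  have hm := (hasDerivAt_id w).const_mul z
  have h2 := hm.div (hm.const_sub 1) n2
  refine ((h2.const_mul γ).const_sub (-α * (z / (1 - z)))).congr_deriv ?_
  simp only [id]
  ring

/-- The PDE of `red_parabola_pde` once all derivatives have been evaluated. -/
lemma red_parabola_identity (κ a i α β g : ℂ) {γ p q p' q' z w : ℂ}
    (hγ : γ = -(κ / 2) * (α * β))
    (hp : p = -(κ / 2) * α ^ 2 + (2 + κ / 2) * α)
    (hq : q = -κ * α ^ 2 + (κ / 2 + 3 + a * i) * α)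
    (hp' : p' = -(κ / 2) * β ^ 2 + (2 + κ / 2) * β)
    (hq' : q' = -κ * β ^ 2 + (κ / 2 + 3 - a * i) * β)
    (hz : 1 - z ≠ 0) (hw : 1 - w ≠ 0) (hzw : 1 - z * w ≠ 0) :
    -(κ / 2) *
        (g * (eulerFactor α γ z w * eulerFactor α γ z w
            + z * (-α / (1 - z) ^ 2 - γ * w / (1 - z * w) ^ 2))
          - g * (eulerFactor α γ z w * eulerFactor β γ w z + z * (-(γ * w) / (1 - w * z) ^ 2))
          - g * (eulerFactor β γ w z * eulerFactor α γ z w + w * (-(γ * z) / (1 - z * w) ^ 2))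
          + g * (eulerFactor β γ w z * eulerFactor β γ w z
            + w * (-β / (1 - w) ^ 2 - γ * z / (1 - w * z) ^ 2)))
      + ((z + 1) / (z - 1) + a * i) * (g * eulerFactor α γ z w)
      + ((w + 1) / (w - 1) - a * i) * (g * eulerFactor β γ w z)
      + (p - q + p' - q') * g
      - (p / (1 - z) ^ 2) * g + (q / (1 - z)) * g
      - (p' / (1 - w) ^ 2) * g + (q' / (1 - w)) * g = 0 := by
  have hz' : (z + 1) / (z - 1) = 1 - 2 / (1 - z) := by
    have : z - 1 ≠ 0 := by rwa [← neg_ne_zero, neg_sub]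
    field_simp
    ring
  have hw' : (w + 1) / (w - 1) = 1 - 2 / (1 - w) := by
    have : w - 1 ≠ 0 := by rwa [← neg_ne_zero, neg_sub]
    field_simp
    ring
  simp only [hp, hq, hp', hq', hγ, eulerFactor, hz', hw', mul_comm w z]
  field_simp
  ring

/-- On the complex 'red parabola' `p = −(κ/2)α² + (2+κ/2)α`,
`q = −κα² + (κ/2+3+ia)α`, the two-point function
`G(z,w) = (1−z)^α (1−w)^{conj α} (1−zw)^{−(κ/2)|α|²}` satisfies the PDE
`𝒫(D)G = 0` on `𝔻 × 𝔻`, where `𝒫(D)` is the drifted whole-plane SLE operator. -/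
theorem red_parabola_pde (κ a : ℝ) (hκ : 0 < κ) (α : ℂ) :
    let p : ℂ := -(κ / 2 : ℂ) * α ^ 2 + (2 + (κ : ℂ) / 2) * α
    let q : ℂ := -(κ : ℂ) * α ^ 2 + ((κ : ℂ) / 2 + 3 + (a : ℂ) * Complex.I) * α
    let G : ℂ → ℂ → ℂ := fun z w =>
      (1 - z) ^ α * (1 - w) ^ ((starRingEnd ℂ) α) *
        (1 - z * w) ^ (-(κ / 2 : ℂ) * (α * (starRingEnd ℂ) α))
    let Dz : (ℂ → ℂ → ℂ) → ℂ → ℂ → ℂ := fun F z w => z * deriv (fun u => F u w) z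
    let Dw : (ℂ → ℂ → ℂ) → ℂ → ℂ → ℂ := fun F z w => w * deriv (fun v => F z v) w
    ∀ z ∈ Metric.ball (0 : ℂ) 1, ∀ w ∈ Metric.ball (0 : ℂ) 1,
      -(κ / 2 : ℂ) * (Dz (Dz G) z w - Dz (Dw G) z w - Dw (Dz G) z w + Dw (Dw G) z w)
        + ((z + 1) / (z - 1) + (a : ℂ) * Complex.I) * Dz G z w
        + ((w + 1) / (w - 1) - (a : ℂ) * Complex.I) * Dw G z w
        + (p - q + (starRingEnd ℂ) p - (starRingEnd ℂ) q) * G z w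
        - (p / (1 - z) ^ 2) * G z w + (q / (1 - z)) * G z w
        - ((starRingEnd ℂ) p / (1 - w) ^ 2) * G z w
        + ((starRingEnd ℂ) q / (1 - w)) * G z w = 0 := by
  intro p q G Dz Dw z hz w hw
  set β := (starRingEnd ℂ) α with hβ
  set γ : ℂ := -(κ / 2 : ℂ) * (α * β) with hγ
  have hG : G = powerProduct α β γ := rfl
  have hDz : ∀ z ∈ Metric.ball (0 : ℂ) 1, ∀ w ∈ Metric.ball (0 : ℂ) 1,
      Dz G z w = powerProduct α β γ z w * eulerFactor α γ z w :=
    fun z hz w hw => euler_powerProduct_left hz hw α β γ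
  have hDw : ∀ z ∈ Metric.ball (0 : ℂ) 1, ∀ w ∈ Metric.ball (0 : ℂ) 1,
      Dw G z w = powerProduct α β γ z w * eulerFactor β γ w z :=
    fun z hz w hw => euler_powerProduct_right hz hw α β γ
  have hzz := euler_powerProduct_mul_left hz hw α β γ (hasDerivAt_eulerFactor_left hz hw α γ)
    fun u hu => hDz u hu w hw
  have hzw := euler_powerProduct_mul_left hz hw α β γ (hasDerivAt_eulerFactor_right hw hz β γ)
    fun u hu => hDw u hu w hw
  have hwz := euler_powerProduct_mul_right hz hw α β γ (hasDerivAt_eulerFactor_right hz hw α γ)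
    fun v hv => hDz z hz v hv
  have hww := euler_powerProduct_mul_right hz hw α β γ (hasDerivAt_eulerFactor_left hw hz β γ)
    fun v hv => hDw z hz v hv
  have hp : (starRingEnd ℂ) p = -(κ / 2 : ℂ) * β ^ 2 + (2 + (κ : ℂ) / 2) * β := by
    simp [p, hβ, map_ofNat]
  have hq : (starRingEnd ℂ) q =
      -(κ : ℂ) * β ^ 2 + ((κ : ℂ) / 2 + 3 - (a : ℂ) * Complex.I) * β := by
    simp [q, hβ, map_ofNat, sub_eq_add_neg]
  have n1 := slitPlane_ne_zero (one_sub_mem_slitPlane hz)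
  have n2 := slitPlane_ne_zero (one_sub_mem_slitPlane hw)
  have n3 := slitPlane_ne_zero (one_sub_mem_slitPlane (mul_mem_unit_ball hz hw))
  change Dz (Dz G) z w = _ at hzz
  change Dz (Dw G) z w = _ at hzw
  change Dw (Dz G) z w = _ at hwz
  change Dw (Dw G) z w = _ at hww
  rw [hzz, hzw, hwz, hww, hDz z hz w hw, hDw z hz w hw, hG]
  exact red_parabola_identity κ a I α β _ hγ rfl rfl hp hq n1 n2 n3
end

section
/- Let κ > 0, a ∈ ℝ with a ≠ 0, and α ∈ ℂ with α ≠ 0. Define p := −(κ/2)α² + (2 + κ/2)α and q := −κα² + (κ/2 + 3 + ia)α. If Im p = 0 and Im q = 0, then α = ((4+κ)/(2κ))·(1 + 2ai/(2+κ)), and moreover p = ((4+κ)²/(8κ))·(1 + 4a²/(2+κ)²) and q = ((4+κ)/(2κ))·(1 + 4a²/(2+κ)²). -/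
open Complex

/-- The unique nontrivial real point on the complex 'red parabola' of drifted
whole-plane SLE: if `p = −(κ/2)α² + (2+κ/2)α` and `q = −κα² + (κ/2+3+ia)α` are both
real (with `a ≠ 0`, `α ≠ 0`), then `α = ((4+κ)/(2κ))(1 + 2ai/(2+κ))`, and `p`, `q`
take the stated real values. -/
theorem red_parabola_real_point (κ a : ℝ) (hκ : 0 < κ) (ha : a ≠ 0) (α : ℂ) (hα : α ≠ 0)
    (hp : (-(κ / 2 : ℂ) * α ^ 2 + (2 + (κ : ℂ) / 2) * α).im = 0)
    (hq : (-(κ : ℂ) * α ^ 2 + ((κ : ℂ) / 2 + 3 + (a : ℂ) * Complex.I) * α).im = 0) :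
    α = (((4 + κ) / (2 * κ) : ℝ) : ℂ) * (1 + 2 * (a : ℂ) * Complex.I / (2 + (κ : ℂ))) ∧
    -(κ / 2 : ℂ) * α ^ 2 + (2 + (κ : ℂ) / 2) * α
      = ((((4 + κ) ^ 2 / (8 * κ)) * (1 + 4 * a ^ 2 / (2 + κ) ^ 2) : ℝ) : ℂ) ∧
    -(κ : ℂ) * α ^ 2 + ((κ : ℂ) / 2 + 3 + (a : ℂ) * Complex.I) * α
      = ((((4 + κ) / (2 * κ)) * (1 + 4 * a ^ 2 / (2 + κ) ^ 2) : ℝ) : ℂ) := by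
  have hκ0 : κ ≠ 0 := hκ.ne'
  have hκ2 : 2 + κ ≠ 0 := by positivity
  have hκc : (κ : ℂ) ≠ 0 := by exact_mod_cast hκ0
  have hκ2c : 2 + (κ : ℂ) ≠ 0 := by exact_mod_cast hκ2
  have hp' : α.im * (2 + κ / 2 - κ * α.re) = 0 := by
    simp [pow_two] at hp
    linear_combination hp
  have hq' : -2 * κ * α.re * α.im + (κ / 2 + 3) * α.im + a * α.re = 0 := by
    simp [pow_two] at hq
    linear_combination hq
  have him : α.im ≠ 0 := by
    intro h
    have hre : α.re = 0 := by simpa [h, ha] using hq'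
    exact hα (Complex.ext hre h)
  have hre : κ * α.re = 2 + κ / 2 := by
    linear_combination -(mul_eq_zero.mp hp').resolve_left him
  have hx : α.re = (4 + κ) / (2 * κ) := by
    field_simp
    linear_combination 2 * hre
  have hy : α.im = (4 + κ) / (2 * κ) * (2 * a / (2 + κ)) := by
    rw [← hx]
    field_simp
    linear_combination -2 * hq' - 4 * α.im * hre
  have hα' : α = (((4 + κ) / (2 * κ) : ℝ) : ℂ) *
      (1 + 2 * (a : ℂ) * Complex.I / (2 + (κ : ℂ))) := by
    rw [← Complex.re_add_im α, hx, hy]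
    push_cast
    ring
  refine ⟨hα', ?_, ?_⟩
  · rw [hα']
    push_cast
    field_simp
    ring_nf
    simp only [Complex.I_sq]
    ring
  · rw [hα']
    push_cast
    field_simp
    ring_nf
    simp only [Complex.I_sq]
    ring
end

section
/- Let q, η₁, δ' ∈ ℝ with q ≠ 2, and suppose 2δ'(δ' + η₁) + (2 − q)(η₁ + q − 3) = 0. Let f₀, f₁ : (0,1) → ℝ with f₀ twice differentiable and f₁ differentiable, satisfying on (0,1) the system: (x−1)f₀'(x) − δ'·f₀(x) + (q−2)·f₁(x) = 0 and 2x(x−1)f₁'(x) − (1 + η₁ + (η₁ − 1 + 2δ')x)·f₁(x) + (η₁ + q − 3)·f₀(x) = 0. Then f₀ satisfies on (0,1) the hypergeometric-type equation x(x−1)f₀''(x) + (((3 − η₁ − 4δ')/2)·x − (1 + η₁)/2)·f₀'(x) − δ'·((1 − η₁ − 2δ')/2)·f₀(x) = 0, i.e. the hypergeometric equation with parameters a = −δ', b = (1 − η₁)/2 − δ', c = (1 + η₁)/2. -/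
open Set

/-- Reduction to hypergeometric form: if `(f₀, f₁)` solve the first-order system coming
from the Fourier-coefficient ODEs of the LLE two-point function at `p = 2`,
`η₂ = 4 − q`, and the parameter `δ'` satisfies
`2δ'(δ' + η₁) + (2 − q)(η₁ + q − 3) = 0`, then `f₀` satisfies the hypergeometric
equation with parameters `a = −δ'`, `b = (1−η₁)/2 − δ'`, `c = (1+η₁)/2`. -/
theorem system_to_hypergeometric (q η₁ δ' : ℝ) (hq : q ≠ 2)
    (hE : 2 * δ' * (δ' + η₁) + (2 - q) * (η₁ + q - 3) = 0)
    (f₀ f₁ : ℝ → ℝ)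
    (hf₀ : ∀ x ∈ Set.Ioo (0:ℝ) 1, DifferentiableAt ℝ f₀ x)
    (hf₀' : ∀ x ∈ Set.Ioo (0:ℝ) 1, DifferentiableAt ℝ (deriv f₀) x)
    (hf₁ : ∀ x ∈ Set.Ioo (0:ℝ) 1, DifferentiableAt ℝ f₁ x)
    (heq1 : ∀ x ∈ Set.Ioo (0:ℝ) 1,
      (x - 1) * deriv f₀ x - δ' * f₀ x + (q - 2) * f₁ x = 0)
    (heq2 : ∀ x ∈ Set.Ioo (0:ℝ) 1,
      2 * x * (x - 1) * deriv f₁ x - (1 + η₁ + (η₁ - 1 + 2 * δ') * x) * f₁ x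
        + (η₁ + q - 3) * f₀ x = 0) :
    ∀ x ∈ Set.Ioo (0:ℝ) 1,
      x * (x - 1) * deriv (deriv f₀) x
        + (((3 - η₁ - 4 * δ') / 2) * x - (1 + η₁) / 2) * deriv f₀ x
        - δ' * ((1 - η₁ - 2 * δ') / 2) * f₀ x = 0 := by
  intro x hx
  have hderiv : deriv f₀ x + (x - 1) * deriv (deriv f₀) x - δ' * deriv f₀ x
      + (q - 2) * deriv f₁ x = 0 := by
    have hd := ((((hasDerivAt_id x).sub_const 1).mul (hf₀' x hx).hasDerivAt).sub
      ((hf₀ x hx).hasDerivAt.const_mul δ')).add ((hf₁ x hx).hasDerivAt.const_mul (q - 2))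
    have hzero : HasDerivAt (fun _ : ℝ => (0 : ℝ)) _ x :=
      hd.congr_of_eventuallyEq (by
        filter_upwards [isOpen_Ioo.mem_nhds hx] with y hy
        simpa using (heq1 y hy).symm)
    have huniq := hzero.unique (hasDerivAt_const x 0)
    simp only [id_eq, one_mul] at huniq
    exact huniq
  have hne : 2 * (x - 1) ≠ 0 := mul_ne_zero two_ne_zero (sub_ne_zero.mpr hx.2.ne)
  refine (mul_eq_zero.mp ?_).resolve_left hne
  linear_combination 2 * x * (x - 1) * hderiv - (q - 2) * heq2 x hx
    - (1 + η₁ + (η₁ - 1 + 2 * δ') * x) * heq1 x hx - f₀ x * hE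
end

section
/- Let q ∈ ℝ with q ≠ 2, and set η₁ := 1 − q. Define θ₀, θ₁ : [0,1) → ℝ by θ₀(ξ) = (1 + ξ)·(1 − ξ)^{−(4−q)} and θ₁(ξ) = −(2/(2−q))·(1 − ξ)^{−(4−q)}. Then θ₀(0) = 1 and, for all ξ ∈ (0,1): (ξ−1)θ₀'(ξ) − (q−3)θ₀(ξ) + (q−2)θ₁(ξ) = 0 and 2ξ(ξ−1)θ₁'(ξ) − (η₁ + 1 + (η₁ + 2q − 7)ξ)·θ₁(ξ) + (η₁ + q − 3)·θ₀(ξ) = 0. (Explicit solution of the LLE Fourier-coefficient system in the integrable case η₁ = 1 − q, extending Loutsenko–Yermolayeva to q ≠ 0; the corresponding spectrum is β(2,q) = 4 − q.) -/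
open Set

theorem hasDerivAt_one_sub_rpow_neg (a : ℝ) {x : ℝ} (hx : x < 1) :
    HasDerivAt (fun y : ℝ => (1 - y) ^ (-a)) (a * (1 - x) ^ (-a) / (1 - x)) x := by
  have h : 1 - x ≠ 0 := (sub_pos.2 hx).ne'
  convert ((hasDerivAt_id' x).const_sub 1).rpow_const (p := -a) (Or.inl h) using 1
  rw [Real.rpow_sub_one h]
  ring

/-- Explicit solution of the LLE Fourier-coefficient system in the integrable case
`η₁ = 1 − q` (with `η₂ = 4 − q`, `θ₂ ≡ 0`): the functions
`θ₀(ξ) = (1+ξ)(1−ξ)^{−(4−q)}` and `θ₁(ξ) = −(2/(2−q))(1−ξ)^{−(4−q)}` satisfy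
`θ₀(0) = 1` and the two Fourier-coefficient ODEs on `(0,1)`. -/
theorem lle_integrable_case_one_minus_q (q : ℝ) (hq : q ≠ 2) :
    let η₁ : ℝ := 1 - q
    let θ₀ : ℝ → ℝ := fun ξ => (1 + ξ) * (1 - ξ) ^ (-(4 - q))
    let θ₁ : ℝ → ℝ := fun ξ => -(2 / (2 - q)) * (1 - ξ) ^ (-(4 - q))
    θ₀ 0 = 1 ∧
    ∀ ξ ∈ Set.Ioo (0:ℝ) 1,
      (ξ - 1) * deriv θ₀ ξ - (q - 3) * θ₀ ξ + (q - 2) * θ₁ ξ = 0 ∧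
      2 * ξ * (ξ - 1) * deriv θ₁ ξ - (η₁ + 1 + (η₁ + 2 * q - 7) * ξ) * θ₁ ξ
        + (η₁ + q - 3) * θ₀ ξ = 0 := by
  intro η₁ θ₀ θ₁
  refine ⟨by simp [θ₀], fun ξ hξ => ?_⟩
  have h1 : 1 - ξ ≠ 0 := (sub_pos.2 hξ.2).ne'
  have h2 : 2 - q ≠ 0 := sub_ne_zero.2 hq.symm
  have hP := hasDerivAt_one_sub_rpow_neg (4 - q) hξ.2
  have h₀ := (((hasDerivAt_id' ξ).const_add 1).mul hP).deriv
  have h₁ := (hP.const_mul (-(2 / (2 - q)))).deriv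
  change deriv θ₀ ξ = _ at h₀
  change deriv θ₁ ξ = _ at h₁
  rw [h₀, h₁]
  simp only [η₁, θ₀, θ₁]
  generalize (1 - ξ) ^ (-(4 - q)) = P
  constructor <;> field_simp <;> ring
end

section
/- Let q, η₁ ∈ ℝ and let 𝔹 be the 3×3 real matrix 𝔹 = (1/2)·[[2(3−q), 2(q−2), 0], [η₁+q−3, −2(η₁+q−3), η₁+q−1], [0, −4, 6]]. Then for every α ∈ ℝ (equivalently, as a polynomial identity in α): det(𝔹 − α·I) = (1/2)·(1 − α)·(2(α + q − 3)(η₁ + α + q − 5) − q(η₁ + q − 3)). In particular, the eigenvalues of 𝔹 are 1 and the two roots α₀^± = 3 − q + (1/2)(2 − η₁ ± √((η₁−2)² + 2q(η₁+q−3))) of E₀(α) := 2(α+q−3)(η₁+α+q−5) − q(η₁+q−3), whenever (η₁−2)² + 2q(η₁+q−3) ≥ 0. -/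
open Matrix

/-- The residue matrix `𝔹` at `ξ = 1` of the Fuchsian system for the LLE
Fourier-coefficient vector (case `η₂ = −q`) has characteristic determinant
`det(𝔹 − αI) = (1/2)(1−α)(2(α+q−3)(η₁+α+q−5) − q(η₁+q−3))`; consequently, when
`(η₁−2)² + 2q(η₁+q−3) ≥ 0`, its eigenvalues are `1` and the two roots
`α₀^± = 3 − q + (1/2)(2 − η₁ ± √((η₁−2)² + 2q(η₁+q−3)))`. -/
theorem fuchsian_residue_matrix_eigenvalues (q η₁ : ℝ) :
    let B : Matrix (Fin 3) (Fin 3) ℝ := (1 / 2 : ℝ) • Matrix.of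
      ![![2 * (3 - q), 2 * (q - 2), 0],
        ![η₁ + q - 3, -2 * (η₁ + q - 3), η₁ + q - 1],
        ![0, -4, 6]]
    (∀ α : ℝ, (B - α • (1 : Matrix (Fin 3) (Fin 3) ℝ)).det
        = (1 / 2) * (1 - α) * (2 * (α + q - 3) * (η₁ + α + q - 5) - q * (η₁ + q - 3))) ∧
    ((η₁ - 2) ^ 2 + 2 * q * (η₁ + q - 3) ≥ 0 →
      spectrum ℝ B =
        {1, 3 - q + (1 / 2) * (2 - η₁ + Real.sqrt ((η₁ - 2) ^ 2 + 2 * q * (η₁ + q - 3))),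
         3 - q + (1 / 2) * (2 - η₁ - Real.sqrt ((η₁ - 2) ^ 2 + 2 * q * (η₁ + q - 3)))}) := by
  intro B
  have hdet : ∀ α : ℝ, (B - α • (1 : Matrix (Fin 3) (Fin 3) ℝ)).det
      = (1 / 2) * (1 - α) * (2 * (α + q - 3) * (η₁ + α + q - 5) - q * (η₁ + q - 3)) := by
    intro α
    simp [B, Matrix.det_fin_three]
    ring
  refine ⟨hdet, fun hdisc => ?_⟩
  ext α
  have hsq := Real.sq_sqrt hdisc
  set s := Real.sqrt ((η₁ - 2) ^ 2 + 2 * q * (η₁ + q - 3))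
  have hfactor : (B - α • (1 : Matrix (Fin 3) (Fin 3) ℝ)).det
      = (1 - α) * ((α - (3 - q + (1 / 2) * (2 - η₁ + s)))
        * (α - (3 - q + (1 / 2) * (2 - η₁ - s)))) := by
    rw [hdet]
    linear_combination (1 - α) / 4 * hsq
  rw [spectrum.mem_iff, IsUnit.sub_iff, Algebra.algebraMap_eq_smul_one,
    Matrix.isUnit_iff_isUnit_det, isUnit_iff_ne_zero, not_not, hfactor,
    mul_eq_zero, mul_eq_zero, sub_eq_zero, sub_eq_zero, sub_eq_zero, eq_comm (a := (1 : ℝ))]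
  rfl
end
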